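/- Suppose f ∈ L²(ℝ) is phase-space localized with tolerance δ₁. Then for every integer m ≥ 0, ‖f⁺ₘ − (1−Pₘ)(Pₘ₋₁ ⋯ P₁ P₀) f‖_{L²} ≤ δ₁·(3m² + 15m + 150·kmax + 12)·‖f‖_{L²}, where for m = 0 the product Pₘ₋₁⋯P₀ is interpreted as the identity operator. -/

import Mathlib

open MeasureTheory Real Complex Set Function
open scoped ENNReal

noncomputable section

/-- The error function `erf x = (2/√π) ∫₀ˣ e^{-t²} dt`. -/
def erf' (x : ℝ) : ℝ := (2 / Real.sqrt Real.pi) * ∫ t in (0:ℝ)..x, Real.exp (-t^2)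

/-- The complementary error function `erfc x = 1 - erf x`. -/
def erfc' (x : ℝ) : ℝ := 1 - erf' x

/-- The inverse of the strictly decreasing bijection `erfc' : [0,∞) → (0,1]`. -/
def erfcInv (y : ℝ) : ℝ := Function.invFunOn erfc' (Set.Ici 0) y

/-- The spatial cutoff χ₀(x) = (1/2)[erf((x+3L/4)/σ) − erf((x−3L/4)/σ)]. -/
def chi0 (L σ x : ℝ) : ℝ := (1/2) * (erf' ((x + 3*L/4)/σ) - erf' ((x - 3*L/4)/σ))

/-- The frequency cutoff P₀(k) = (1/2)[erf(σ(k+3kmax/8)) − erf(σ(k−3kmax/8))]. -/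
def P0fun (kmax σ k : ℝ) : ℝ := (1/2) * (erf' (σ*(k + 3*kmax/8)) - erf' (σ*(k - 3*kmax/8)))

/-- The scaled spatial cutoff χₘ(x) = χ₀(2^{-m} x). -/
def chiSc (L σ : ℝ) (m : ℕ) (x : ℝ) : ℝ := chi0 L σ (x / 2^m)

/-- The scaled frequency cutoff Pₘ(k) = P₀(2^m k). -/
def PSc (kmax σ : ℝ) (m : ℕ) (k : ℝ) : ℝ := P0fun kmax σ (2^m * k)

/-- Fourier transform with the convention f̂(k) = (2π)^{-1/2} ∫ f(x) e^{-ikx} dx. -/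
def ft (f : ℝ → ℂ) (k : ℝ) : ℂ :=
  (Real.sqrt (2*Real.pi) : ℂ)⁻¹ * ∫ x : ℝ, Complex.exp (-(Complex.I * k * x)) * f x

/-- Inverse Fourier transform with the convention (2π)^{-1/2} ∫ g(k) e^{ikx} dk. -/
def ift (g : ℝ → ℂ) (x : ℝ) : ℂ :=
  (Real.sqrt (2*Real.pi) : ℂ)⁻¹ * ∫ k : ℝ, Complex.exp (Complex.I * k * x) * g k

/-- The space L²(ℝ, ℂ). -/
abbrev L2 := Lp ℂ 2 (volume : Measure ℝ)

/-- `T` is the bounded Fourier multiplier operator on L² with symbol `m`: on the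
dense set of `f ∈ L¹ ∩ L²` with integrable Fourier transform, `T f = 𝓕⁻¹(m·𝓕f)`.
(This uniquely determines `T` for a bounded symbol.) -/
def IsMultOp (m : ℝ → ℝ) (T : L2 →L[ℂ] L2) : Prop :=
  ∀ f : L2, Integrable (f : ℝ → ℂ) volume → Integrable (ft (f : ℝ → ℂ)) volume →
    (T f : ℝ → ℂ) =ᵐ[volume] ift (fun k => (m k : ℂ) * ft (f : ℝ → ℂ) k)

/-- `T` is the operator of pointwise multiplication by the real function `c`. -/
def IsMulBy (c : ℝ → ℝ) (T : L2 →L[ℂ] L2) : Prop :=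
  ∀ f : L2, (T f : ℝ → ℂ) =ᵐ[volume] fun x => (c x : ℂ) * f x

lemma integrable_exp_neg_sq : Integrable (fun t : ℝ => Real.exp (-t ^ 2)) := by
  simpa using integrable_exp_neg_mul_sq one_pos

lemma erf'_mono : Monotone erf' := by
  intro x y hxy
  unfold erf'
  gcongr
  have h := intervalIntegral.integral_add_adjacent_intervals
    (integrable_exp_neg_sq.intervalIntegrable (a := 0) (b := x))
    (integrable_exp_neg_sq.intervalIntegrable (a := x) (b := y))
  have hpos : 0 ≤ ∫ t in x..y, Real.exp (-t ^ 2) :=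
    intervalIntegral.integral_nonneg hxy fun t _ => (Real.exp_pos _).le
  linarith

lemma erf'_neg (x : ℝ) : erf' (-x) = -erf' x := by
  unfold erf'
  have h := intervalIntegral.integral_comp_neg (a := 0) (b := x)
    (fun t : ℝ => Real.exp (-t ^ 2))
  simp only [neg_zero, neg_sq] at h
  rw [h, intervalIntegral.integral_symm (-x) 0]
  ring

lemma erf'_zero : erf' 0 = 0 := by simp [erf']

lemma continuous_erf' : Continuous erf' :=
  continuous_const.mul
    (intervalIntegral.continuous_primitive
      (fun _ _ => integrable_exp_neg_sq.intervalIntegrable) 0)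

lemma tendsto_erf'_atTop : Filter.Tendsto erf' Filter.atTop (nhds 1) := by
  have h := (MeasureTheory.intervalIntegral_tendsto_integral_Ioi (0 : ℝ)
    integrable_exp_neg_sq.integrableOn Filter.tendsto_id).const_mul (2 / √π)
  have hI : ∫ t in Ioi (0 : ℝ), Real.exp (-t ^ 2) = √π / 2 := by
    simpa using integral_gaussian_Ioi 1
  have hpi : √π ≠ 0 := (Real.sqrt_pos.mpr Real.pi_pos).ne'
  rw [hI, show 2 / √π * (√π / 2) = 1 by field_simp] at h
  exact h

lemma erf'_le_one (x : ℝ) : erf' x ≤ 1 :=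
  erf'_mono.ge_of_tendsto tendsto_erf'_atTop x

lemma neg_one_le_erf' (x : ℝ) : -1 ≤ erf' x := by
  have := erf'_le_one (-x)
  rw [erf'_neg] at this
  linarith

lemma erfc'_erfcInv {δ : ℝ} (hδ : 0 < δ) (hδ1 : δ ≤ erfc' 1) : erfc' (erfcInv δ) = δ := by
  have hlim : Filter.Tendsto erfc' Filter.atTop (nhds 0) := by
    simpa [funext_iff, erfc', Function.comp_def] using! tendsto_erf'_atTop.const_sub 1
  obtain ⟨b, hb, hb1⟩ :=
    ((hlim.eventually_lt_const hδ).and (Filter.eventually_ge_atTop 1)).exists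
  have hcont : Continuous erfc' := continuous_const.sub continuous_erf'
  obtain ⟨a, ha, hab⟩ := intermediate_value_Icc' hb1 hcont.continuousOn ⟨hb.le, hδ1⟩
  exact Function.invFunOn_eq ⟨a, zero_le_one.trans ha.1, hab⟩

lemma erf'_erfcInv {δ : ℝ} (hδ : 0 < δ) (hδ1 : δ ≤ erfc' 1) : erf' (erfcInv δ) = 1 - δ := by
  have := erfc'_erfcInv hδ hδ1
  unfold erfc' at this
  linarith

lemma erfcInv_pos {δ : ℝ} (hδ : 0 < δ) (hδ1 : δ ≤ erfc' 1) : 0 < erfcInv δ := by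
  by_contra! h
  have h1 : 1 - erf' (erfcInv δ) ≤ 1 - erf' 1 := by
    rw [erf'_erfcInv hδ hδ1]
    simpa [erfc'] using hδ1
  have h2 : erf' (erfcInv δ) ≤ 0 := erf'_zero ▸ erf'_mono h
  have h3 : erf' 1 = 0 := le_antisymm (by linarith) (erf'_zero ▸ erf'_mono zero_le_one)
  have h4 : 0 < ∫ t in (0 : ℝ)..1, Real.exp (-t ^ 2) :=
    intervalIntegral.intervalIntegral_pos_of_pos
      integrable_exp_neg_sq.intervalIntegrable (fun _ => Real.exp_pos _) one_pos
  have hpi : 0 < √π := Real.sqrt_pos.mpr Real.pi_pos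
  unfold erf' at h3
  have : 0 < 2 / √π * ∫ t in (0 : ℝ)..1, Real.exp (-t ^ 2) := by positivity
  exact this.ne' h3

lemma continuous_P0fun (K σ : ℝ) : Continuous (P0fun K σ) := by
  have := continuous_erf'
  unfold P0fun
  fun_prop

lemma P0fun_nonneg {K σ : ℝ} (hK : 0 ≤ K) (hσ : 0 ≤ σ) (k : ℝ) : 0 ≤ P0fun K σ k := by
  have : erf' (σ * (k - 3 * K / 8)) ≤ erf' (σ * (k + 3 * K / 8)) :=
    erf'_mono (mul_le_mul_of_nonneg_left (by linarith) hσ)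
  unfold P0fun
  linarith

lemma P0fun_le_one (K σ k : ℝ) : P0fun K σ k ≤ 1 := by
  have h1 := erf'_le_one (σ * (k + 3 * K / 8))
  have h2 := neg_one_le_erf' (σ * (k - 3 * K / 8))
  unfold P0fun
  linarith

lemma P0fun_neg (K σ k : ℝ) : P0fun K σ (-k) = P0fun K σ k := by
  unfold P0fun
  rw [show σ * (-k + 3 * K / 8) = -(σ * (k - 3 * K / 8)) by ring,
    show σ * (-k - 3 * K / 8) = -(σ * (k + 3 * K / 8)) by ring, erf'_neg, erf'_neg]
  ring

lemma P0fun_abs (K σ k : ℝ) : P0fun K σ |k| = P0fun K σ k := by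
  rcases abs_choice k with h | h <;> simp [h, P0fun_neg]

lemma P0fun_le {K σ δ : ℝ} (hσ : 0 ≤ σ) (hδ : 0 < δ) (hδ1 : δ ≤ erfc' 1)
    (hD : 8 * erfcInv δ ≤ σ * K) {k : ℝ} (hk : K / 2 ≤ |k|) : P0fun K σ k ≤ δ := by
  rw [← P0fun_abs]
  have h1 := erf'_le_one (σ * (|k| + 3 * K / 8))
  have h2 : erf' (erfcInv δ) ≤ erf' (σ * (|k| - 3 * K / 8)) := by
    apply erf'_mono
    have := mul_le_mul_of_nonneg_left hk hσ
    linarith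
  rw [erf'_erfcInv hδ hδ1] at h2
  unfold P0fun
  linarith

lemma one_sub_P0fun_le {K σ δ : ℝ} (hσ : 0 ≤ σ) (hδ : 0 < δ) (hδ1 : δ ≤ erfc' 1)
    (hD : 8 * erfcInv δ ≤ σ * K) {k : ℝ} (hk : |k| ≤ K / 4) : 1 - P0fun K σ k ≤ δ := by
  rw [← P0fun_abs]
  have hk' := mul_le_mul_of_nonneg_left hk hσ
  have h0 := mul_nonneg hσ (abs_nonneg k)
  have hpos := erfcInv_pos hδ hδ1
  have h1 : erf' (erfcInv δ) ≤ erf' (σ * (|k| + 3 * K / 8)) := erf'_mono (by linarith)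
  have h2 : erf' (σ * (|k| - 3 * K / 8)) ≤ erf' (-erfcInv δ) := erf'_mono (by linarith)
  rw [erf'_neg] at h2
  rw [erf'_erfcInv hδ hδ1] at h1 h2
  unfold P0fun
  linarith

lemma chi0_eq_P0fun (L σ : ℝ) : chi0 L σ = P0fun (2 * L) σ⁻¹ := by
  ext x
  unfold chi0 P0fun
  congr 3 <;> ring_nf

lemma one_sub_chiSc_mul_chiSc_le {L σ δ : ℝ} (hL : 0 ≤ L) (hσ : 0 ≤ σ) (hδ : 0 < δ)
    (hδ1 : δ ≤ erfc' 1) (hD : 8 * erfcInv δ ≤ σ⁻¹ * (2 * L)) (m : ℕ) (x : ℝ) :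
    (1 - chiSc L σ (m + 1) x) * chiSc L σ m x ≤ δ := by
  have hL2 : 0 ≤ 2 * L := by linarith
  have hσ' := inv_nonneg.mpr hσ
  unfold chiSc
  rw [chi0_eq_P0fun]
  have a0 := P0fun_nonneg hL2 hσ' (x / 2 ^ m)
  have a1 := P0fun_le_one (2 * L) σ⁻¹ (x / 2 ^ m)
  have b0 := P0fun_nonneg hL2 hσ' (x / 2 ^ (m + 1))
  have b1 := P0fun_le_one (2 * L) σ⁻¹ (x / 2 ^ (m + 1))
  rcases le_total L |x / 2 ^ m| with h | h
  · have := P0fun_le hσ' hδ hδ1 hD (k := x / 2 ^ m) (by linarith)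
    nlinarith
  · have h' : |x / 2 ^ (m + 1)| ≤ 2 * L / 4 := by
      rw [pow_succ, ← div_div, abs_div, abs_two]
      linarith
    have := one_sub_P0fun_le hσ' hδ hδ1 hD h'
    nlinarith

lemma one_sub_prod_PSc_le {K σ δ : ℝ} (hK : 0 ≤ K) (hσ : 0 ≤ σ) (hδ : 0 < δ)
    (hδ1 : δ ≤ erfc' 1) (hD : 8 * erfcInv δ ≤ σ * K) (m : ℕ) {k : ℝ}
    (hk : 2 ^ m * |k| ≤ K / 2) : 1 - ∏ j ∈ Finset.range m, PSc K σ j k ≤ m * δ := by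
  induction m with
  | zero => simp
  | succ m ih =>
    rw [pow_succ] at hk
    have hpos : 0 ≤ 2 ^ m * |k| := by positivity
    have h1 := ih (by linarith)
    have h2 : 1 - PSc K σ m k ≤ δ :=
      one_sub_P0fun_le hσ hδ hδ1 hD
        (by rw [abs_mul, abs_of_pos (show (0 : ℝ) < 2 ^ m by positivity)]; linarith)
    have h3 : PSc K σ m k ≤ 1 := P0fun_le_one _ _ _
    have h4 : ∏ j ∈ Finset.range m, PSc K σ j k ≤ 1 :=
      Finset.prod_le_one (fun j _ => P0fun_nonneg hK hσ _) fun j _ => P0fun_le_one _ _ _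
    rw [Finset.prod_range_succ]
    push_cast
    nlinarith

lemma PSc_mul_one_sub_prod_le {K σ δ : ℝ} (hK : 0 ≤ K) (hσ : 0 ≤ σ) (hδ : 0 < δ)
    (hδ1 : δ ≤ erfc' 1) (hD : 8 * erfcInv δ ≤ σ * K) (m : ℕ) (k : ℝ) :
    |PSc K σ m k * (1 - ∏ j ∈ Finset.range m, PSc K σ j k)| ≤ m * δ := by
  have a0 : 0 ≤ PSc K σ m k := P0fun_nonneg hK hσ _
  have a1 : PSc K σ m k ≤ 1 := P0fun_le_one _ _ _
  have b0 : 0 ≤ ∏ j ∈ Finset.range m, PSc K σ j k :=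
    Finset.prod_nonneg fun j _ => P0fun_nonneg hK hσ _
  have b1 : ∏ j ∈ Finset.range m, PSc K σ j k ≤ 1 :=
    Finset.prod_le_one (fun j _ => P0fun_nonneg hK hσ _) fun j _ => P0fun_le_one _ _ _
  rw [abs_of_nonneg (mul_nonneg a0 (by linarith))]
  rcases le_total (K / 2) (2 ^ m * |k|) with h | h
  · rcases m.eq_zero_or_pos with rfl | hm
    · simp
    · have h1 : PSc K σ m k ≤ δ :=
        P0fun_le hσ hδ hδ1 hD
          (by rwa [abs_mul, abs_of_pos (show (0 : ℝ) < 2 ^ m by positivity)])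
      have hm' : (1 : ℝ) ≤ m := by exact_mod_cast hm
      nlinarith
  · have := one_sub_prod_PSc_le hK hσ hδ hδ1 hD m h
    nlinarith

lemma exists_isMulBy {c : ℝ → ℝ} (hc : Continuous c) {C : ℝ} (hC : ∀ x, |c x| ≤ C) :
    ∃ M : L2 →L[ℂ] L2, IsMulBy c M := by
  have hmem : MemLp (fun x => (c x : ℂ)) ∞ (volume : Measure ℝ) :=
    memLp_top_of_bound (by fun_prop) C (.of_forall fun x => by simpa using hC x)
  refine ⟨(ContinuousLinearMap.mul ℂ ℂ).holderL volume ∞ 2 2 hmem.toLp, fun f => ?_⟩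
  filter_upwards [(ContinuousLinearMap.mul ℂ ℂ).coeFn_holder (r := 2) hmem.toLp f,
    hmem.coeFn_toLp] with x hx hx'
  simp only [ContinuousLinearMap.holderL_apply_apply]
  rw [hx, hx']
  rfl

lemma norm_le_of_ae_eq_mul {c : ℝ → ℝ} {C : ℝ} (hC : ∀ x, |c x| ≤ C) {f g : L2}
    (h : g =ᵐ[volume] fun x => (c x : ℂ) * f x) : ‖g‖ ≤ C * ‖f‖ := by
  refine Lp.norm_le_mul_norm_of_ae_le_mul ?_
  filter_upwards [h] with x hx
  rw [hx, norm_mul, Complex.norm_real]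
  gcongr
  exact hC x

lemma IsMulBy.norm_le {c : ℝ → ℝ} {T : L2 →L[ℂ] L2} (hT : IsMulBy c T) {C : ℝ}
    (hC : ∀ x, |c x| ≤ C) (f : L2) : ‖T f‖ ≤ C * ‖f‖ :=
  norm_le_of_ae_eq_mul hC (hT f)

lemma IsMulBy.one_sub {c : ℝ → ℝ} {T : L2 →L[ℂ] L2} (hT : IsMulBy c T) :
    IsMulBy (fun x => 1 - c x) (1 - T) := by
  intro f
  change (f - T f : L2) =ᵐ[volume] _
  filter_upwards [Lp.coeFn_sub f (T f), hT f] with x h1 h2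
  rw [h1, Pi.sub_apply, h2]
  push_cast
  ring

lemma IsMulBy.mul {c d : ℝ → ℝ} {S T : L2 →L[ℂ] L2} (hS : IsMulBy c S) (hT : IsMulBy d T) :
    IsMulBy (fun x => c x * d x) (S * T) := by
  intro f
  filter_upwards [hS (T f), hT f] with x h1 h2
  change S (T f) x = _
  rw [h1, h2]
  push_cast
  ring

lemma IsMulBy.inner_left {c : ℝ → ℝ} {T : L2 →L[ℂ] L2} (hT : IsMulBy c T) (f g : L2) :
    inner ℂ (T f) g = inner ℂ f (T g) := by
  rw [L2.inner_def, L2.inner_def]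
  apply integral_congr_ae
  filter_upwards [hT f, hT g] with x h1 h2
  rw [h1, h2]
  simp [RCLike.inner_apply]
  ring

/-- `T` acts as multiplication by `c` on the Fourier side, in Mathlib's normalization. -/
def IsFourierMulBy (c : ℝ → ℝ) (T : L2 →L[ℂ] L2) : Prop :=
  ∀ f : L2, Lp.fourierTransformₗᵢ ℝ ℂ (T f) =ᵐ[volume]
    fun x => (c x : ℂ) * Lp.fourierTransformₗᵢ ℝ ℂ f x

lemma IsFourierMulBy.norm_le {c : ℝ → ℝ} {T : L2 →L[ℂ] L2} (hT : IsFourierMulBy c T) {C : ℝ}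
    (hC : ∀ x, |c x| ≤ C) (f : L2) : ‖T f‖ ≤ C * ‖f‖ := by
  simpa only [LinearIsometryEquiv.norm_map] using norm_le_of_ae_eq_mul hC (hT f)

lemma isFourierMulBy_one : IsFourierMulBy (fun _ => 1) 1 := fun f => by simp

lemma IsFourierMulBy.sub {c d : ℝ → ℝ} {S T : L2 →L[ℂ] L2} (hS : IsFourierMulBy c S)
    (hT : IsFourierMulBy d T) : IsFourierMulBy (fun x => c x - d x) (S - T) := by
  intro f
  change Lp.fourierTransformₗᵢ ℝ ℂ (S f - T f) =ᵐ[volume] _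
  rw [map_sub]
  filter_upwards [Lp.coeFn_sub (Lp.fourierTransformₗᵢ ℝ ℂ (S f))
    (Lp.fourierTransformₗᵢ ℝ ℂ (T f)), hS f, hT f] with x h1 h2 h3
  rw [h1, Pi.sub_apply, h2, h3]
  push_cast
  ring

lemma IsFourierMulBy.mul {c d : ℝ → ℝ} {S T : L2 →L[ℂ] L2} (hS : IsFourierMulBy c S)
    (hT : IsFourierMulBy d T) : IsFourierMulBy (fun x => c x * d x) (S * T) := by
  intro f
  filter_upwards [hS (T f), hT f] with x h1 h2
  change Lp.fourierTransformₗᵢ ℝ ℂ (S (T f)) x = _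
  rw [h1, h2]
  push_cast
  ring

lemma ft_eq_fourier (f : ℝ → ℂ) (k : ℝ) :
    ft f k = (√(2 * π) : ℂ)⁻¹ * FourierTransform.fourier f (k / (2 * π)) := by
  rw [ft, Real.fourier_eq']
  congr 2
  ext x
  have hpi : (π : ℂ) ≠ 0 := by exact_mod_cast Real.pi_ne_zero
  rw [smul_eq_mul]
  congr 2
  simp only [RCLike.inner_apply, conj_trivial]
  push_cast
  field_simp

lemma ift_mul_ft (m : ℝ → ℝ) (f : ℝ → ℂ) :
    ift (fun k => (m k : ℂ) * ft f k) = FourierTransform.fourierInv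
      (fun ξ => (m (2 * π * ξ) : ℂ) * FourierTransform.fourier f ξ) := by
  ext x
  have hpi : (0 : ℝ) < 2 * π := by positivity
  have hpi' : (π : ℂ) ≠ 0 := by exact_mod_cast Real.pi_ne_zero
  have hsq : (√(2 * π) : ℂ)⁻¹ * (√(2 * π) : ℂ)⁻¹ * ((2 * π : ℝ) : ℂ) = 1 := by
    have h1 : (√(2 * π) : ℂ) * √(2 * π) = ((2 * π : ℝ) : ℂ) := by
      rw [← Complex.ofReal_mul, Real.mul_self_sqrt hpi.le]
    have h2 : (√(2 * π) : ℂ) ≠ 0 := by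
      exact_mod_cast (Real.sqrt_pos.mpr hpi).ne'
    rw [← h1]
    field_simp
  rw [ift, Real.fourierInv_eq']
  set G : ℝ → ℂ := fun ξ => Complex.exp (↑(2 * π * inner ℝ ξ x) * Complex.I) •
    ((m (2 * π * ξ) : ℂ) * FourierTransform.fourier f ξ)
  have hG : ∀ k : ℝ, Complex.exp (Complex.I * k * x) * ((m k : ℂ) * ft f k) =
      (√(2 * π) : ℂ)⁻¹ * G (k / (2 * π)) := by
    intro k
    have e1 : 2 * π * (k / (2 * π)) = k := by field_simp
    have e2 : (↑(2 * π * inner ℝ (k / (2 * π)) x) * Complex.I : ℂ) = Complex.I * k * x := by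
      simp only [RCLike.inner_apply, conj_trivial]
      push_cast
      field_simp
    simp only [G]
    rw [ft_eq_fourier, e1, e2, smul_eq_mul]
    ring
  simp_rw [hG]
  rw [integral_const_mul, Measure.integral_comp_div, abs_of_pos hpi, Complex.real_smul,
    ← mul_assoc, ← mul_assoc, hsq, one_mul]

open FourierTransform in
lemma integral_inner_fourierInv_eq {f g : ℝ → ℂ} (hf : Integrable f) (hg : Integrable g) :
    ∫ x, inner ℂ (f x) (𝓕⁻ g x) = ∫ ξ, inner ℂ (𝓕 f ξ) (g ξ) := by
  have h := VectorFourier.integral_sesq_fourierIntegral_eq_neg_flip (innerSL ℂ) (L := innerₗ ℝ)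
    Real.continuous_fourierChar continuous_inner hf hg
  simp only [innerSL_apply_apply, flip_innerₗ] at h
  exact h.symm

open FourierTransform SchwartzMap in
lemma IsMultOp.ae_eq_fourierInv {m : ℝ → ℝ} {T : L2 →L[ℂ] L2} (hT : IsMultOp m T)
    {f : 𝓢(ℝ, ℂ)} {g : L2} (hg : g =ᵐ[volume] f) :
    T g =ᵐ[volume] 𝓕⁻ (fun ξ => (m (2 * π * ξ) : ℂ) * 𝓕 (f : ℝ → ℂ) ξ) := by
  have hft : ft g = ft f := by
    ext k
    rw [ft_eq_fourier, ft_eq_fourier, Real.fourier_congr_ae hg]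
  have hint : Integrable (ft g) := by
    have hpi : 2 * π ≠ 0 := by positivity
    rw [hft, funext (ft_eq_fourier f)]
    exact (Integrable.comp_div (𝓕 f).integrable hpi).const_mul _
  have hTg := hT g (f.integrable.congr hg.symm) hint
  rwa [hft, ift_mul_ft] at hTg

set_option maxHeartbeats 800000 in
open FourierTransform SchwartzMap in
lemma IsMultOp.fourier_toLp_eq {m : ℝ → ℝ} {T M : L2 →L[ℂ] L2} (hT : IsMultOp m T)
    (hm : Continuous m) {C : ℝ} (hC : ∀ x, |m x| ≤ C)
    (hM : IsMulBy (fun ξ => m (2 * π * ξ)) M) (f : 𝓢(ℝ, ℂ)) :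
    Lp.fourierTransformₗᵢ ℝ ℂ (T (f.toLp 2)) = M ((𝓕 f).toLp 2) := by
  have hdense : DenseRange (toLpCLM ℂ (E := ℝ) ℂ 2 volume) :=
    denseRange_toLpCLM ENNReal.ofNat_ne_top
  have hF : ∀ g : 𝓢(ℝ, ℂ), Lp.fourierTransformₗᵢ ℝ ℂ (g.toLp 2) = (𝓕 g).toLp 2 :=
    fun g => g.toLp_fourier_eq
  have hTf := hT.ae_eq_fourierInv (f.coeFn_toLp 2)
  have hhint : Integrable fun ξ => (m (2 * π * ξ) : ℂ) * 𝓕 (f : ℝ → ℂ) ξ :=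
    Integrable.bdd_mul (c := C) (𝓕 f).integrable
      (Continuous.aestronglyMeasurable (by fun_prop))
      (.of_forall fun x => by simpa using hC _)
  rw [← LinearIsometryEquiv.eq_symm_apply]
  refine hdense.eq_of_inner_right ℂ fun g => ?_
  rw [toLpCLM_apply, ← (Lp.fourierTransformₗᵢ ℝ ℂ).inner_map_map _
    ((Lp.fourierTransformₗᵢ ℝ ℂ).symm _), LinearIsometryEquiv.apply_symm_apply, hF,
    L2.inner_def, L2.inner_def]
  calc _ = ∫ x, inner ℂ (g x) (𝓕⁻ (fun ξ => (m (2 * π * ξ) : ℂ) * 𝓕 (f : ℝ → ℂ) ξ) x) := by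
        apply integral_congr_ae
        filter_upwards [hTf, g.coeFn_toLp 2] with x h1 h2
        rw [h1, h2]
    _ = _ := by
        rw [integral_inner_fourierInv_eq g.integrable hhint]
        apply integral_congr_ae
        filter_upwards [hM ((𝓕 f).toLp 2), (𝓕 f).coeFn_toLp 2, (𝓕 g).coeFn_toLp 2]
          with x h1 h2 h3
        rw [h1, h2, h3]
        rfl

lemma IsMultOp.isFourierMulBy {m : ℝ → ℝ} {T : L2 →L[ℂ] L2} (hT : IsMultOp m T)
    (hm : Continuous m) {C : ℝ} (hC : ∀ x, |m x| ≤ C) :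
    IsFourierMulBy (fun ξ => m (2 * π * ξ)) T := by
  obtain ⟨M, hM⟩ := exists_isMulBy (c := fun ξ => m (2 * π * ξ)) (by fun_prop) fun x => hC _
  have hdense : DenseRange (SchwartzMap.toLpCLM ℂ (E := ℝ) ℂ 2 volume) :=
    SchwartzMap.denseRange_toLpCLM ENNReal.ofNat_ne_top
  have heq := hdense.equalizer ((Lp.fourierTransformₗᵢ ℝ ℂ).continuous.comp T.continuous)
    (M.continuous.comp (Lp.fourierTransformₗᵢ ℝ ℂ).continuous)
    (funext fun f => (hT.fourier_toLp_eq hm hC hM f).trans (congrArg M f.toLp_fourier_eq.symm))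
  intro f
  rw [show Lp.fourierTransformₗᵢ ℝ ℂ (T f) = M (Lp.fourierTransformₗᵢ ℝ ℂ f)
    from congrFun heq f]
  exact hM _

lemma norm_sub_mul_mul_le {c a : ℝ → ℝ} {X A : L2 →L[ℂ] L2} (hX : IsMulBy c X)
    (hc : ∀ x, |c x| ≤ 1) (hA : IsFourierMulBy a A) (ha0 : ∀ x, 0 ≤ a x) (ha1 : ∀ x, a x ≤ 1)
    (f : L2) : ‖f - X (A (X f))‖ ≤ ‖f‖ := by
  have hrefl : ‖X f - (2 : ℂ) • A (X f)‖ ≤ ‖X f‖ := by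
    have h := ((isFourierMulBy_one.sub hA).sub hA).norm_le (C := 1)
      (fun x => abs_le.mpr ⟨by linarith [ha1 x], by linarith [ha0 x]⟩) (X f)
    rw [one_mul] at h
    convert h using 2
    change _ = X f - A (X f) - A (X f)
    rw [two_smul, sub_sub]
  have hXA : ‖X (A (X f))‖ ≤ ‖A (X f)‖ := by simpa using hX.norm_le hc (A (X f))
  have h1 := norm_sub_sq (𝕜 := ℂ) (X f) ((2 : ℂ) • A (X f))
  have h2 := norm_sub_sq (𝕜 := ℂ) f (X (A (X f)))
  rw [← hX.inner_left] at h2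
  rw [inner_smul_right, norm_smul] at h1
  have h3 : RCLike.re ((2 : ℂ) * inner ℂ (X f) (A (X f))) =
      2 * RCLike.re (inner ℂ (X f) (A (X f))) := by simp
  rw [h3, Complex.norm_ofNat] at h1
  have h4 : ‖X f - (2 : ℂ) • A (X f)‖ ^ 2 ≤ ‖X f‖ ^ 2 := by gcongr
  have h5 : ‖X (A (X f))‖ ^ 2 ≤ ‖A (X f)‖ ^ 2 := by gcongr
  exact le_of_sq_le_sq (by nlinarith) (norm_nonneg _)

/-- ‖f⁺ₘ − (1−Pₘ)(Pₘ₋₁⋯P₀) f‖ ≤ δ₁(3m²+15m+150 kmax+12)‖f‖, where for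
m = 0 the product Pₘ₋₁⋯P₀ is the identity. -/
theorem stmt4 (L kmax σ δ₁ : ℝ) (hL : 0 < L) (hk : 0 < kmax) (hσ : 0 < σ)
    (hδpos : 0 < δ₁) (hδle : δ₁ ≤ erfc' 1)
    (hσlo : 8 * erfcInv δ₁ / kmax ≤ σ) (hσhi : σ ≤ L / (8 * erfcInv δ₁))
    (X P : ℕ → (L2 →L[ℂ] L2))
    (hX : ∀ m, IsMulBy (chiSc L σ m) (X m)) (hP : ∀ m, IsMultOp (PSc kmax σ m) (P m))
    (f : L2)
    -- f is phase-space localized with tolerance δ₁: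
    (hloc : ∀ m, ‖(1 - P m) f - X m ((1 - P m) (X m f))‖ ≤ δ₁ * ‖f‖)
    -- the recursive multiscale decomposition f⁺ₘ, f⁻ₘ:
    (fp fm : ℕ → L2)
    (hfp0 : fp 0 = X 0 ((1 - P 0) (X 0 f)))
    (hfm0 : fm 0 = f - fp 0)
    (hfpS : ∀ m, fp (m+1) = X (m+1) ((1 - P (m+1)) (X (m+1) (fm m))))
    (hfmS : ∀ m, fm (m+1) = fm m - fp (m+1))
    -- R m = Pₘ₋₁ ∘ ⋯ ∘ P₀ (with R 0 = id):
    (R : ℕ → (L2 →L[ℂ] L2))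
    (hR0 : R 0 = 1)
    (hRS : ∀ m, R (m+1) = (P m).comp (R m))
    (m : ℕ) :
    ‖fp m - (1 - P m) (R m f)‖
      ≤ δ₁ * (3*(m:ℝ)^2 + 15*(m:ℝ) + 150*kmax + 12) * ‖f‖ := by
  have hD0 := erfcInv_pos hδpos hδle
  have hDk : 8 * erfcInv δ₁ ≤ σ * kmax := (div_le_iff₀ hk).mp hσlo
  have hDL : 8 * erfcInv δ₁ ≤ σ⁻¹ * (2 * L) := by
    rw [le_div_iff₀ (by positivity)] at hσhi
    rw [inv_mul_eq_div, le_div_iff₀ hσ]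
    linarith
  have hc0 : ∀ m x, 0 ≤ chiSc L σ m x := fun m x => by
    rw [chiSc, chi0_eq_P0fun]
    exact P0fun_nonneg (by positivity) (by positivity) _
  have hc1 : ∀ m x, chiSc L σ m x ≤ 1 := fun m x => by
    rw [chiSc, chi0_eq_P0fun]
    exact P0fun_le_one _ _ _
  have hp0 : ∀ m k, 0 ≤ PSc kmax σ m k := fun m k => P0fun_nonneg hk.le hσ.le _
  have hp1 : ∀ m k, PSc kmax σ m k ≤ 1 := fun m k => P0fun_le_one _ _ _
  have hc : ∀ m x, |chiSc L σ m x| ≤ 1 := fun m x =>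
    abs_le.mpr ⟨by linarith [hc0 m x], hc1 m x⟩
  have hPF : ∀ m, IsFourierMulBy (fun ξ => PSc kmax σ m (2 * π * ξ)) (P m) := fun m =>
    (hP m).isFourierMulBy ((continuous_P0fun _ _).comp (by fun_prop)) (C := 1) fun x =>
      abs_le.mpr ⟨by linarith [hp0 m x], hp1 m x⟩
  have hAF : ∀ m, IsFourierMulBy (fun ξ => 1 - PSc kmax σ m (2 * π * ξ)) (1 - P m) :=
    fun m => isFourierMulBy_one.sub (hPF m)
  have hRF : ∀ m, IsFourierMulBy
      (fun ξ => ∏ j ∈ Finset.range m, PSc kmax σ j (2 * π * ξ)) (R m) := by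
    intro m
    induction m with
    | zero => simpa [hR0] using isFourierMulBy_one
    | succ m ih =>
      rw [hRS]
      simp_rw [Finset.prod_range_succ, mul_comm _ (PSc kmax σ m _)]
      exact (hPF m).mul ih
  have hXle : ∀ m g, ‖X m g‖ ≤ ‖g‖ := fun m g => by simpa using (hX m).norm_le (hc m) g
  have hYle : ∀ m (g : L2), ‖g - X m g‖ ≤ ‖g‖ := fun m g => by
    simpa using (hX m).one_sub.norm_le (C := 1)
      (fun x => abs_le.mpr ⟨by linarith [hc1 m x], by linarith [hc0 m x]⟩) g
  have hAle : ∀ m g, ‖(1 - P m) g‖ ≤ ‖g‖ := fun m g => by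
    simpa using (hAF m).norm_le (C := 1)
      (fun x => abs_le.mpr ⟨by linarith [hp1 m (2 * π * x)], by linarith [hp0 m (2 * π * x)]⟩) g
  have hYX : ∀ m (g : L2), ‖X m g - X (m + 1) (X m g)‖ ≤ δ₁ * ‖g‖ := fun m g =>
    ((hX (m + 1)).one_sub.mul (hX m)).norm_le (fun x => by
      rw [abs_of_nonneg (mul_nonneg (by linarith [hc1 (m + 1) x]) (hc0 m x))]
      exact one_sub_chiSc_mul_chiSc_le hL.le hσ.le hδpos hδle hDL m x) g
  have hPQ : ∀ m, ‖P m (f - R m f)‖ ≤ m * δ₁ * ‖f‖ := fun m =>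
    ((hPF m).mul (isFourierMulBy_one.sub (hRF m))).norm_le (fun x =>
      PSc_mul_one_sub_prod_le hk.le hσ.le hδpos hδle hDk m (2 * π * x)) f
  have hf := norm_nonneg f
  have hYQ : ∀ m, ‖(f - R m f) - X m (f - R m f)‖ ≤ (m + 1) * δ₁ * ‖f‖ := by
    intro m
    cases m with
    | zero =>
      simp only [hR0, one_apply_eq_self, sub_self, map_zero, norm_zero]
      positivity
    | succ m =>
      set g := X m ((1 - P m) (X m f))
      have hsplit : (f - R (m + 1) f) - X (m + 1) (f - R (m + 1) f) =
          (((1 - P m) f - g) - X (m + 1) ((1 - P m) f - g)) + (g - X (m + 1) g) +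
            (P m (f - R m f) - X (m + 1) (P m (f - R m f))) := by
        rw [hRS]
        simp only [ContinuousLinearMap.comp_apply, sub_apply,
          one_apply_eq_self, map_sub]
        abel
      have h1 := (hYle (m + 1) _).trans (hloc m)
      have h2 : ‖g - X (m + 1) g‖ ≤ δ₁ * ‖f‖ := (hYX m _).trans
        (mul_le_mul_of_nonneg_left ((hAle m _).trans (hXle m f)) hδpos.le)
      have h3 := (hYle (m + 1) _).trans (hPQ m)
      rw [hsplit]
      refine (norm_add₃_le.trans (add_le_add (add_le_add h1 h2) h3)).trans (le_of_eq ?_)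
      push_cast
      ring
  have hη : ∀ m, ‖(1 - P m) (R m f) - X m ((1 - P m) (X m (R m f)))‖ ≤
      (3 * m + 3) * δ₁ * ‖f‖ := by
    intro m
    set q := f - R m f with hq
    have hRq : R m f = f - q := by rw [hq]; abel
    have hsplit : (1 - P m) (R m f) - X m ((1 - P m) (X m (R m f))) =
        ((1 - P m) f - X m ((1 - P m) (X m f))) - (q - X m q) + (P m q - X m (P m q)) -
          X m ((1 - P m) (q - X m q)) := by
      rw [hRq]
      simp only [sub_apply, one_apply_eq_self, map_sub]
      abel
    have h3 := (hYle m _).trans (hPQ m)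
    have h4 := ((hXle m _).trans (hAle m _)).trans (hYQ m)
    rw [hsplit]
    refine (norm_sub_le _ _).trans ((add_le_add ((norm_add_le _ _).trans
      (add_le_add ((norm_sub_le _ _).trans (add_le_add (hloc m) (hYQ m))) h3)) h4).trans
      (le_of_eq ?_))
    ring
  have hstep : ∀ m (g : L2), ‖X m ((1 - P m) (X m g)) - (1 - P m) (R m f)‖ ≤
      ‖g - R m f‖ + (3 * m + 3) * δ₁ * ‖f‖ := by
    intro m g
    have hsplit : X m ((1 - P m) (X m g)) - (1 - P m) (R m f) =
        X m ((1 - P m) (X m (g - R m f))) -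
          ((1 - P m) (R m f) - X m ((1 - P m) (X m (R m f)))) := by
      simp only [map_sub]
      abel
    rw [hsplit]
    exact (norm_sub_le _ _).trans (add_le_add
      (((hXle m _).trans (hAle m _)).trans (hXle m _)) (hη m))
  have hrem : ∀ m (g : L2), ‖(g - X m ((1 - P m) (X m g))) - R (m + 1) f‖ ≤
      ‖g - R m f‖ + (3 * m + 3) * δ₁ * ‖f‖ := by
    intro m g
    have hsplit : (g - X m ((1 - P m) (X m g))) - R (m + 1) f =
        ((g - R m f) - X m ((1 - P m) (X m (g - R m f)))) +
          ((1 - P m) (R m f) - X m ((1 - P m) (X m (R m f)))) := by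
      rw [hRS]
      simp only [ContinuousLinearMap.comp_apply, sub_apply,
        one_apply_eq_self, map_sub]
      abel
    rw [hsplit]
    exact (norm_add_le _ _).trans (add_le_add (norm_sub_mul_mul_le (hX m) (hc m) (hAF m)
      (fun x => by linarith [hp1 m (2 * π * x)]) (fun x => by linarith [hp0 m (2 * π * x)]) _)
      (hη m))
  have hfm : ∀ m : ℕ, ‖fm m - R (m + 1) f‖ ≤ 3 / 2 * (m + 1) * (m + 2) * δ₁ * ‖f‖ := by
    intro m
    induction m with
    | zero =>
      rw [hfm0, hfp0]
      refine (hrem 0 f).trans (le_of_eq ?_)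
      simp [hR0]
    | succ m ih =>
      rw [hfmS, hfpS]
      refine (hrem (m + 1) (fm m)).trans ((add_le_add_left ih _).trans (le_of_eq ?_))
      push_cast
      ring
  have hkey : ‖fp m - (1 - P m) (R m f)‖ ≤ 3 / 2 * (m + 1) * (m + 2) * δ₁ * ‖f‖ := by
    cases m with
    | zero =>
      rw [hfp0]
      refine (hstep 0 f).trans (le_of_eq ?_)
      simp [hR0]
    | succ m =>
      rw [hfpS]
      refine (hstep (m + 1) (fm m)).trans ((add_le_add_left (hfm m) _).trans (le_of_eq ?_))
      push_cast
      ring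
  refine hkey.trans (mul_le_mul_of_nonneg_right ?_ hf)
  rw [mul_comm _ δ₁]
  refine mul_le_mul_of_nonneg_left ?_ hδpos.le
  have hm : (0 : ℝ) ≤ m := m.cast_nonneg
  nlinarith [sq_nonneg (m : ℝ)]

end
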